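/- Let V be a finite type, r : V → V → Prop a digraph, U a finite type of inputs, E_B : Finset (V × U), and w : V × U → ℝ with w e ≥ 0 for all e ∈ E_B. Suppose the set of source strongly connected components of r is finite and every source strongly connected component contains a vertex v with (v, u) ∈ E_B for some u. Then every accessible subset F ⊆ E_B satisfies ∑_{e ∈ F} w e ≥ ∑_C min { w e | e ∈ E_B, e.1 ∈ C }, where the sum runs over all source strongly connected components C of r, and this lower bound is attained by some accessible F ⊆ E_B. In particular, the minimum cost over all accessible subsets of E_B coincides with the minimum cost over accessible subsets of minimum cardinality. -/

import Mathlib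

/-- A set `C` is a source strongly connected component (SSCC) of the digraph `r`. -/
def IsSSCC {V : Type*} (r : V → V → Prop) (C : Set V) : Prop :=
  ∃ v : V, C = {u | Relation.ReflTransGen r u v ∧ Relation.ReflTransGen r v u} ∧
    ∀ w : V, Relation.ReflTransGen r w v → Relation.ReflTransGen r v w

/-- A set of input-connections `F` is accessible if every vertex is reachable from
some vertex hit by an input-connection of `F`. -/
def Accessible {V U : Type*} (r : V → V → Prop) (F : Finset (V × U)) : Prop :=
  ∀ v : V, ∃ x : V, (∃ u : U, (x, u) ∈ F) ∧ Relation.ReflTransGen r x v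

theorem IsSSCC.mem_of_reflTransGen {V : Type*} {r : V → V → Prop} {C : Set V}
    (hC : IsSSCC r C) {x v : V} (hv : v ∈ C) (hxv : Relation.ReflTransGen r x v) : x ∈ C := by
  obtain ⟨a, rfl, ha⟩ := hC
  exact ⟨hxv.trans hv.1, ha x (hxv.trans hv.1)⟩

theorem IsSSCC.nonempty {V : Type*} {r : V → V → Prop} {C : Set V} (hC : IsSSCC r C) :
    C.Nonempty := by
  obtain ⟨a, rfl, -⟩ := hC
  exact ⟨a, .refl, .refl⟩

theorem IsSSCC.reflTransGen {V : Type*} {r : V → V → Prop} {C : Set V} (hC : IsSSCC r C)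
    {x y : V} (hx : x ∈ C) (hy : y ∈ C) : Relation.ReflTransGen r x y := by
  obtain ⟨a, rfl, -⟩ := hC
  exact hx.1.trans hy.2

theorem IsSSCC.eq_of_mem {V : Type*} {r : V → V → Prop} {C D : Set V} (hC : IsSSCC r C)
    (hD : IsSSCC r D) {v : V} (hvC : v ∈ C) (hvD : v ∈ D) : C = D :=
  Set.Subset.antisymm
    (fun _ hx => hD.mem_of_reflTransGen hvD (hC.reflTransGen hx hvC))
    (fun _ hx => hC.mem_of_reflTransGen hvC (hD.reflTransGen hx hvD))

/-- In a finite digraph every vertex is reachable from a source strongly connected component. -/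
theorem exists_isSSCC_reflTransGen {V : Type*} [Finite V] (r : V → V → Prop) (v : V) :
    ∃ C, IsSSCC r C ∧ ∃ x ∈ C, Relation.ReflTransGen r x v := by
  let s : V → V → Prop := fun x y =>
    Relation.ReflTransGen r x y ∧ ¬ Relation.ReflTransGen r y x
  have : IsTrans V s := ⟨fun _ _ _ hab hbc =>
    ⟨hab.1.trans hbc.1, fun hca => hab.2 (hbc.1.trans hca)⟩⟩
  have : Std.Irrefl s := ⟨fun _ h => h.2 h.1⟩
  obtain ⟨m, hm, hmin⟩ := (Finite.wellFounded_of_trans_of_irrefl s).has_min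
    {x | Relation.ReflTransGen r x v} ⟨v, .refl⟩
  refine ⟨_, ⟨m, rfl, fun y hy => ?_⟩, m, ⟨.refl, .refl⟩, hm⟩
  by_contra h
  exact hmin y (hy.trans hm) ⟨hy, h⟩

theorem Accessible.exists_mem_isSSCC {V U : Type*} {r : V → V → Prop} {F : Finset (V × U)}
    (hF : Accessible r F) {C : Set V} (hC : IsSSCC r C) : ∃ e ∈ F, e.1 ∈ C := by
  obtain ⟨v, hv⟩ := hC.nonempty
  obtain ⟨x, ⟨u, hu⟩, hxv⟩ := hF v
  exact ⟨(x, u), hu, hC.mem_of_reflTransGen hv hxv⟩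

theorem accessible_of_forall_isSSCC {V U : Type*} [Finite V] {r : V → V → Prop}
    {F : Finset (V × U)} (hF : ∀ C, IsSSCC r C → ∃ e ∈ F, e.1 ∈ C) : Accessible r F := by
  intro v
  obtain ⟨C, hC, x, hx, hxv⟩ := exists_isSSCC_reflTransGen r v
  obtain ⟨e, he, heC⟩ := hF C hC
  exact ⟨e.1, ⟨e.2, he⟩, (hC.reflTransGen heC hx).trans hxv⟩

/-- Connections chosen in distinct source strongly connected components are distinct. -/
theorem injective_of_fst_mem_isSSCC {V U : Type*} {r : V → V → Prop} {T : Finset (Set V)}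
    (hT : ∀ C ∈ T, IsSSCC r C) {g : T → V × U} (hg : ∀ C : T, (g C).1 ∈ C.1) :
    Function.Injective g := fun C D h =>
  Subtype.ext <| (hT C C.2).eq_of_mem (hT D D.2) (hg C) (h ▸ hg D)

/-- An accessible set contains one connection per source strongly connected component. -/
theorem Accessible.exists_injective {V U : Type*} {r : V → V → Prop} {F : Finset (V × U)}
    (hF : Accessible r F) {T : Finset (Set V)} (hT : ∀ C ∈ T, IsSSCC r C) :
    ∃ g : T → V × U, Function.Injective g ∧ ∀ C : T, g C ∈ F ∧ (g C).1 ∈ C.1 := by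
  choose g hgF hgC using fun C : T => hF.exists_mem_isSSCC (hT C C.2)
  exact ⟨g, injective_of_fst_mem_isSSCC hT hgC, fun C => ⟨hgF C, hgC C⟩⟩

theorem Accessible.card_le {V U : Type*} {r : V → V → Prop} {F : Finset (V × U)}
    (hF : Accessible r F) {T : Finset (Set V)} (hT : ∀ C ∈ T, IsSSCC r C) :
    T.card ≤ F.card := by
  obtain ⟨g, hinj, hg⟩ := hF.exists_injective hT
  rw [← Fintype.card_coe, ← Finset.card_univ]
  exact Finset.card_le_card_of_injOn g (fun C _ => (hg C).1) hinj.injOn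

theorem Accessible.sum_le {V U : Type*} {r : V → V → Prop} {F : Finset (V × U)}
    (hF : Accessible r F) {T : Finset (Set V)} (hT : ∀ C ∈ T, IsSSCC r C)
    {w : V × U → ℝ} (hw : ∀ e ∈ F, 0 ≤ w e) {c : Set V → ℝ}
    (hc : ∀ C ∈ T, ∀ e ∈ F, e.1 ∈ C → c C ≤ w e) :
    ∑ C ∈ T, c C ≤ ∑ e ∈ F, w e := by
  classical
  obtain ⟨g, hinj, hg⟩ := hF.exists_injective hT
  calc ∑ C ∈ T, c C = ∑ C : T, c C := (Finset.sum_coe_sort T c).symm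
    _ ≤ ∑ C : T, w (g C) := Finset.sum_le_sum fun C _ => hc C C.2 _ (hg C).1 (hg C).2
    _ = ∑ e ∈ Finset.univ.image g, w e := (Finset.sum_image hinj.injOn).symm
    _ ≤ ∑ e ∈ F, w e := Finset.sum_le_sum_of_subset_of_nonneg
        (Finset.image_subset_iff.2 fun C _ => (hg C).1) fun e he _ => hw e he

theorem exists_isLeast_cost {V U : Type*} {E : Finset (V × U)} (w : V × U → ℝ) {C : Set V}
    (h : ∃ v ∈ C, ∃ u : U, (v, u) ∈ E) :
    ∃ e ∈ E, e.1 ∈ C ∧ IsLeast {x : ℝ | ∃ e ∈ E, e.1 ∈ C ∧ w e = x} (w e) := by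
  classical
  obtain ⟨v, hv, u, hu⟩ := h
  obtain ⟨e, he, hmin⟩ := (E.filter fun e => e.1 ∈ C).exists_min_image w
    ⟨(v, u), Finset.mem_filter.2 ⟨hu, hv⟩⟩
  obtain ⟨heE, heC⟩ := Finset.mem_filter.1 he
  refine ⟨e, heE, heC, ⟨e, heE, heC, rfl⟩, ?_⟩
  rintro _ ⟨e', he', heC', rfl⟩
  exact hmin e' (Finset.mem_filter.2 ⟨he', heC'⟩)

/-- Every accessible subset of `E_B` has cost at least the sum, over all source
strongly connected components `C`, of the cheapest available input-connection
entering `C`; this bound is attained, and the minimum cost over all accessible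
subsets coincides with the minimum cost over accessible subsets of minimum
cardinality. -/
theorem min_cost_accessible_eq_min_cost_sparsest {V U : Type*} [Fintype V] [Fintype U]
    (r : V → V → Prop) (E_B : Finset (V × U)) (w : V × U → ℝ)
    (hw : ∀ e ∈ E_B, 0 ≤ w e)
    (hfin : {C : Set V | IsSSCC r C}.Finite)
    (hcov : ∀ C : Set V, IsSSCC r C → ∃ v ∈ C, ∃ u : U, (v, u) ∈ E_B) :
    (∀ F ⊆ E_B, Accessible r F →
        ∑ C ∈ hfin.toFinset, sInf {x : ℝ | ∃ e ∈ E_B, e.1 ∈ C ∧ w e = x} ≤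
          ∑ e ∈ F, w e) ∧
    (∃ F ⊆ E_B, Accessible r F ∧
        ∑ e ∈ F, w e =
          ∑ C ∈ hfin.toFinset, sInf {x : ℝ | ∃ e ∈ E_B, e.1 ∈ C ∧ w e = x}) ∧
    sInf {c : ℝ | ∃ F ⊆ E_B, Accessible r F ∧ ∑ e ∈ F, w e = c} =
      sInf {c : ℝ | ∃ F ⊆ E_B, Accessible r F ∧
        (∀ F' ⊆ E_B, Accessible r F' → F.card ≤ F'.card) ∧ ∑ e ∈ F, w e = c} := by
  classical
  have hT : ∀ C ∈ hfin.toFinset, IsSSCC r C := fun C hC => hfin.mem_toFinset.1 hC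
  choose g hgE hgC hgmin using fun C : hfin.toFinset =>
    exists_isLeast_cost w (hcov C (hT C C.2))
  have hinj : Function.Injective g := injective_of_fst_mem_isSSCC hT hgC
  have hlower : ∀ F ⊆ E_B, Accessible r F →
      ∑ C ∈ hfin.toFinset, sInf {x : ℝ | ∃ e ∈ E_B, e.1 ∈ C ∧ w e = x} ≤ ∑ e ∈ F, w e := by
    intro F hF hacc
    refine hacc.sum_le hT (fun e he => hw e (hF he)) fun C hC e he heC => ?_
    exact csInf_le ⟨_, (hgmin ⟨C, hC⟩).2⟩ ⟨e, hF he, heC, rfl⟩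
  have hsub : Finset.univ.image g ⊆ E_B := Finset.image_subset_iff.2 fun C _ => hgE C
  have hacc : Accessible r (Finset.univ.image g) := accessible_of_forall_isSSCC fun C hC =>
    ⟨g ⟨C, hfin.mem_toFinset.2 hC⟩, Finset.mem_image_of_mem g (Finset.mem_univ _),
      hgC ⟨C, hfin.mem_toFinset.2 hC⟩⟩
  have hsum : ∑ e ∈ Finset.univ.image g, w e =
      ∑ C ∈ hfin.toFinset, sInf {x : ℝ | ∃ e ∈ E_B, e.1 ∈ C ∧ w e = x} := by
    rw [Finset.sum_image hinj.injOn, ← Finset.sum_coe_sort hfin.toFinset]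
    exact Finset.sum_congr rfl fun C _ => (hgmin C).csInf_eq.symm
  have hcard : ∀ F' ⊆ E_B, Accessible r F' → (Finset.univ.image g).card ≤ F'.card := by
    intro F' _ hF'
    rw [Finset.card_image_of_injective _ hinj, Finset.card_univ, Fintype.card_coe]
    exact hF'.card_le hT
  refine ⟨hlower, ⟨_, hsub, hacc, hsum⟩, ?_⟩
  trans ∑ C ∈ hfin.toFinset, sInf {x : ℝ | ∃ e ∈ E_B, e.1 ∈ C ∧ w e = x}
  · refine IsLeast.csInf_eq ⟨⟨_, hsub, hacc, hsum⟩, ?_⟩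
    rintro _ ⟨F, hF, hFacc, rfl⟩
    exact hlower F hF hFacc
  · symm
    refine IsLeast.csInf_eq ⟨⟨_, hsub, hacc, hcard, hsum⟩, ?_⟩
    rintro _ ⟨F, hF, hFacc, -, rfl⟩
    exact hlower F hF hFacc
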